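/- (Anisotropic Sobolev product law) Let s, t < 1 with s + t > 0 and s', t' < 1/2 with s' + t' > 0. Then there exists a constant C > 0 such that for all Schwartz functions u and v on ℝ³, ‖uv‖_{H^{s+t−1, s'+t'−1/2}} ≤ C ‖u‖_{H^{s,s'}} ‖v‖_{H^{t,t'}}. -/

import Mathlib

/- Anisotropic Sobolev product law (Theorem "th:Loianiso"): for s, t < 1 with s + t > 0 and
s', t' < 1/2 with s' + t' > 0, `‖uv‖_{H^{s+t-1, s'+t'-1/2}} ≤ C ‖u‖_{H^{s,s'}} ‖v‖_{H^{t,t'}}`. -/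

open MeasureTheory Real
open scoped FourierTransform ENNReal
noncomputable section

abbrev E3 := EuclideanSpace ℝ (Fin 3)

/-- anisotropic Sobolev norm `H^{σ₁,σ₂}(ℝ³)`, defined through the Fourier transform. -/
def anisoNorm (σ₁ σ₂ : ℝ) (f : E3 → ℂ) : ℝ :=
  (∫ ξ : E3, (1 + ((ξ 0)^2 + (ξ 1)^2)) ^ σ₁ * (1 + (ξ 2)^2) ^ σ₂ * ‖𝓕 f ξ‖^2) ^ (1/2 : ℝ)

/-- The `L²` norm of an `ℝ≥0∞`-valued function. -/
def ltwo {X : Type*} [MeasurableSpace X] (μ : Measure X) (F : X → ℝ≥0∞) : ℝ≥0∞ :=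
  (∫⁻ x, F x ^ 2 ∂μ) ^ (1 / 2 : ℝ)

/-- Boundedness on `L² × L² × L²`, with constant `C`, of the twisted convolution form with
kernel `K`. -/
def TrilinearBound {X : Type*} [Sub X] [MeasurableSpace X] (μ : Measure X)
    (K : X → X → ℝ≥0∞) (C : ℝ≥0∞) : Prop :=
  ∀ F G H : X → ℝ≥0∞, Measurable F → Measurable G → Measurable H →
    ∫⁻ z, ∫⁻ x, K z x * (F (z - x) * G x * H z) ∂μ ∂μ ≤ C * (ltwo μ F * ltwo μ G * ltwo μ H)

section LTwo

variable {X Y : Type*} [MeasurableSpace X] [MeasurableSpace Y] {μ : Measure X} {ν : Measure Y}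

lemma ltwo_sq (F : X → ℝ≥0∞) : ltwo μ F ^ 2 = ∫⁻ x, F x ^ 2 ∂μ := by
  rw [ltwo, ← ENNReal.rpow_natCast, ← ENNReal.rpow_mul]
  norm_num

lemma lintegral_mul_le_ltwo {F G : X → ℝ≥0∞} (hF : Measurable F) (hG : Measurable G) :
    ∫⁻ x, F x * G x ∂μ ≤ ltwo μ F * ltwo μ G := by
  have h := ENNReal.lintegral_mul_le_Lp_mul_Lq μ Real.HolderConjugate.two_two
    hF.aemeasurable hG.aemeasurable
  simpa only [ltwo, ENNReal.rpow_two, Pi.mul_apply] using h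

@[fun_prop]
lemma measurable_ltwo_prod [SFinite μ] {F : X × Y → ℝ≥0∞} (hF : Measurable F) :
    Measurable fun y => ltwo μ fun x => F (x, y) := by
  unfold ltwo
  have : Measurable fun p : Y × X => F (p.2, p.1) ^ 2 := by fun_prop
  exact this.lintegral_prod_right'.pow_const _

lemma ltwo_prod [SFinite μ] [SFinite ν] {F : X × Y → ℝ≥0∞} (hF : Measurable F) :
    ltwo ν (fun y => ltwo μ fun x => F (x, y)) = ltwo (μ.prod ν) F := by
  conv_lhs => rw [ltwo]
  simp_rw [ltwo_sq]
  rw [ltwo, lintegral_prod_symm' _ (by fun_prop)]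

lemma MeasureTheory.MeasurePreserving.ltwo_comp {e : X → Y} (he : MeasurePreserving e μ ν)
    {F : Y → ℝ≥0∞} (hF : Measurable F) : ltwo μ (fun x => F (e x)) = ltwo ν F := by
  rw [ltwo, ltwo, he.lintegral_comp (f := fun y => F y ^ 2) (by fun_prop)]

end LTwo

namespace TrilinearBound

section Group

variable {X : Type*} [AddCommGroup X] [MeasurableSpace X] {μ : Measure X}
  {K L : X → X → ℝ≥0∞} {C D : ℝ≥0∞}

lemma mono (h : TrilinearBound μ L C) (hKL : ∀ z x, K z x ≤ L z x) : TrilinearBound μ K C :=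
  fun F G H hF hG hH => (lintegral_mono fun z => lintegral_mono fun x => by
    gcongr; exact hKL z x).trans (h F G H hF hG hH)

lemma add [MeasurableSub₂ X] [SFinite μ] (hK : TrilinearBound μ K C) (hL : TrilinearBound μ L D)
    (hKm : Measurable (Function.uncurry K)) :
    TrilinearBound μ (fun z x => K z x + L z x) (C + D) := by
  intro F G H hF hG hH
  have h : Measurable fun p : X × X => K p.1 p.2 * (F (p.1 - p.2) * G p.2 * H p.1) :=
    hKm.mul (by fun_prop)
  simp_rw [add_mul]
  have h1 : ∀ z, Measurable fun x => K z x * (F (z - x) * G x * H z) := fun z =>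
    h.comp (measurable_const.prodMk measurable_id)
  simp_rw [fun z => lintegral_add_left (μ := μ) (h1 z)]
  rw [lintegral_add_left h.lintegral_prod_right']
  exact add_le_add (hK F G H hF hG hH) (hL F G H hF hG hH)

lemma const_mul (hK : TrilinearBound μ K C) (hD : D ≠ ∞) :
    TrilinearBound μ (fun z x => D * K z x) (D * C) := by
  intro F G H hF hG hH
  simp_rw [mul_assoc D]
  simp_rw [lintegral_const_mul' D _ hD]
  gcongr
  exact hK F G H hF hG hH

lemma reflect [MeasurableAdd₂ X] [MeasurableNeg X] [μ.IsAddLeftInvariant] [μ.IsNegInvariant]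
    (hK : TrilinearBound μ K C) : TrilinearBound μ (fun z x => K z (z - x)) C := by
  intro F G H hF hG hH
  have h := hK G F H hG hF hH
  rw [mul_comm (ltwo μ F)]
  refine le_of_eq_of_le (lintegral_congr fun z => ?_) h
  rw [← lintegral_sub_left_eq_self _ z]
  simp [mul_comm (F _)]

lemma swap [MeasurableNeg X] [MeasurableSub₂ X] [SFinite μ] [μ.IsNegInvariant]
    (hK : TrilinearBound μ K C) (hKm : Measurable (Function.uncurry K)) :
    TrilinearBound μ (fun z x => K x z) C := by
  intro F G H hF hG hH
  have h := hK (fun x => F (-x)) H G (by fun_prop) hH hG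
  have hneg : ltwo μ (fun x => F (-x)) = ltwo μ F :=
    (Measure.measurePreserving_neg μ).ltwo_comp hF
  rw [hneg, mul_right_comm] at h
  refine le_of_eq_of_le ?_ h
  rw [lintegral_lintegral_swap]
  · simp [mul_right_comm]
  · have : Measurable fun p : X × X => K p.2 p.1 := hKm.comp measurable_swap
    exact (this.mul (by fun_prop)).aemeasurable

lemma of_lintegral_sq_le [MeasurableAdd₂ X] [MeasurableNeg X] [MeasurableSub₂ X] [SFinite μ]
    [μ.IsAddLeftInvariant] (hKm : Measurable (Function.uncurry K))
    (h : ∀ z, ∫⁻ x, K z x ^ 2 ∂μ ≤ C) : TrilinearBound μ K (C ^ (1 / 2 : ℝ)) := by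
  intro F G H hF hG hH
  have hKz : ∀ z, Measurable (K z) := fun z => hKm.comp (measurable_const.prodMk measurable_id)
  have hFG : Measurable fun z => ltwo μ fun x => F (z - x) * G x :=
    measurable_ltwo_prod (F := fun p : X × X => F (p.2 - p.1) * G p.1) (by fun_prop)
  have hnorm : ltwo μ (fun z => ltwo μ fun x => F (z - x) * G x) = ltwo μ F * ltwo μ G := by
    conv_lhs => rw [ltwo]
    simp_rw [ltwo_sq, mul_pow]
    rw [lintegral_lintegral_swap (by fun_prop)]
    have : ∀ y, ∫⁻ x, F (x - y) ^ 2 * G y ^ 2 ∂μ = (∫⁻ x, F x ^ 2 ∂μ) * G y ^ 2 := fun y => by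
      rw [lintegral_mul_const _ (by fun_prop), lintegral_sub_right_eq_self (fun x => F x ^ 2)]
    simp_rw [this]
    rw [lintegral_const_mul _ (by fun_prop), ENNReal.mul_rpow_of_nonneg _ _ (by norm_num), ltwo,
      ltwo]
  calc ∫⁻ z, ∫⁻ x, K z x * (F (z - x) * G x * H z) ∂μ ∂μ
      = ∫⁻ z, (∫⁻ x, K z x * (F (z - x) * G x) ∂μ) * H z ∂μ := by
        refine lintegral_congr fun z => ?_
        simp_rw [← mul_assoc]
        rw [← lintegral_mul_const _ ?_]
        have := hKz z
        fun_prop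
    _ ≤ ∫⁻ z, C ^ (1 / 2 : ℝ) * ((ltwo μ fun x => F (z - x) * G x) * H z) ∂μ := by
        refine lintegral_mono fun z => ?_
        rw [← mul_assoc]
        gcongr
        refine (lintegral_mul_le_ltwo (hKz z) (by fun_prop)).trans ?_
        gcongr
        exact ENNReal.rpow_le_rpow (h z) (by norm_num)
    _ ≤ C ^ (1 / 2 : ℝ) * (ltwo μ F * ltwo μ G * ltwo μ H) := by
        rw [lintegral_const_mul _ (by fun_prop), ← hnorm]
        gcongr
        exact lintegral_mul_le_ltwo hFG hH

end Group

lemma prod {X Y : Type*} [AddCommGroup X] [MeasurableSpace X] [MeasurableSub₂ X]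
    [AddCommGroup Y] [MeasurableSpace Y] [MeasurableSub₂ Y]
    {μ : Measure X} {ν : Measure Y} [SFinite μ] [SFinite ν]
    {K : X → X → ℝ≥0∞} {L : Y → Y → ℝ≥0∞} {C D : ℝ≥0∞}
    (hK : TrilinearBound μ K C) (hL : TrilinearBound ν L D)
    (hKm : Measurable (Function.uncurry K)) (hLm : Measurable (Function.uncurry L)) :
    TrilinearBound (μ.prod ν) (fun z x => K z.1 x.1 * L z.2 x.2) (C * D) := by
  intro F G H hF hG hH
  set Φ : X × Y → X × Y → ℝ≥0∞ := fun z x =>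
    K z.1 x.1 * L z.2 x.2 * (F (z - x) * G x * H z) with hΦ
  have hΦm : Measurable (Function.uncurry Φ) := by
    have h1 : Measurable fun p : (X × Y) × (X × Y) => K p.1.1 p.2.1 :=
      hKm.comp (g := Function.uncurry K) (f := fun p : (X × Y) × (X × Y) => (p.1.1, p.2.1))
        (by fun_prop)
    have h2 : Measurable fun p : (X × Y) × (X × Y) => L p.1.2 p.2.2 :=
      hLm.comp (g := Function.uncurry L) (f := fun p : (X × Y) × (X × Y) => (p.1.2, p.2.2))
        (by fun_prop)
    simp only [hΦ, Function.uncurry_def, Prod.sub_def]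
    fun_prop
  have hcomp {Z : Type _} [MeasurableSpace Z] {f g : Z → X × Y} (hf : Measurable f)
      (hg : Measurable g) : Measurable fun p => Φ (f p) (g p) := hΦm.comp (hf.prodMk hg)
  calc ∫⁻ z, ∫⁻ x, Φ z x ∂μ.prod ν ∂μ.prod ν
      = ∫⁻ y', ∫⁻ z', ∫⁻ y, ∫⁻ x, Φ (z', y') (x, y) ∂μ ∂ν ∂μ ∂ν := by
        rw [lintegral_prod_symm' (fun z => ∫⁻ x, Φ z x ∂μ.prod ν) hΦm.lintegral_prod_right']
        simp_rw [fun z => lintegral_prod_symm' (μ := μ) (ν := ν) (Φ z)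
          (hcomp measurable_const measurable_id)]
    _ = ∫⁻ y', ∫⁻ y, ∫⁻ z', ∫⁻ x, Φ (z', y') (x, y) ∂μ ∂μ ∂ν ∂ν := by
        refine lintegral_congr fun y' => ?_
        rw [lintegral_lintegral_swap]
        exact (hcomp (f := fun p : (X × Y) × X => (p.1.1, y')) (g := fun p => (p.2, p.1.2))
          (by fun_prop) (by fun_prop)).lintegral_prod_right'.aemeasurable
    _ ≤ ∫⁻ y', ∫⁻ y, C * (L y' y * ((ltwo μ fun x => F (x, y' - y)) * (ltwo μ fun x => G (x, y))
          * (ltwo μ fun x => H (x, y')))) ∂ν ∂ν := by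
        refine lintegral_mono fun y' => lintegral_mono fun y => ?_
        have h := hK (fun x => F (x, y' - y)) (fun x => G (x, y)) (fun x => H (x, y'))
          (by fun_prop) (by fun_prop) (by fun_prop)
        calc _ = L y' y * ∫⁻ z, ∫⁻ x, K z x * (F (z - x, y' - y) * G (x, y) * H (z, y')) ∂μ ∂μ := by
              have h1 : Measurable fun p : X × X =>
                  K p.1 p.2 * (F (p.1 - p.2, y' - y) * G (p.2, y) * H (p.1, y')) :=
                hKm.mul (by fun_prop)
              rw [← lintegral_const_mul _ h1.lintegral_prod_right']
              refine lintegral_congr fun z => ?_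
              rw [← lintegral_const_mul]
              · refine lintegral_congr fun x => ?_
                simp only [hΦ, Prod.mk_sub_mk]
                ring
              · exact h1.comp (measurable_const.prodMk measurable_id)
          _ ≤ _ := by
              rw [mul_left_comm C]
              gcongr
    _ = C * ∫⁻ y', ∫⁻ y, L y' y * ((ltwo μ fun x => F (x, y' - y)) * (ltwo μ fun x => G (x, y))
          * (ltwo μ fun x => H (x, y'))) ∂ν ∂ν := by
        have hF' := measurable_ltwo_prod (μ := μ) hF
        have hG' := measurable_ltwo_prod (μ := μ) hG
        have hH' := measurable_ltwo_prod (μ := μ) hH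
        have h1 : Measurable fun p : Y × Y => L p.1 p.2 * ((ltwo μ fun x => F (x, p.1 - p.2)) *
            (ltwo μ fun x => G (x, p.2)) * (ltwo μ fun x => H (x, p.1))) :=
          hLm.mul (((hF'.comp (measurable_fst.sub measurable_snd)).mul
            (hG'.comp measurable_snd)).mul (hH'.comp measurable_fst))
        rw [← lintegral_const_mul _ h1.lintegral_prod_right']
        refine lintegral_congr fun y' => ?_
        rw [← lintegral_const_mul]
        exact h1.comp (measurable_const.prodMk measurable_id)
    _ ≤ C * D * (ltwo (μ.prod ν) F * ltwo (μ.prod ν) G * ltwo (μ.prod ν) H) := by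
        rw [mul_assoc C, ← ltwo_prod hF, ← ltwo_prod hG, ← ltwo_prod hH]
        gcongr
        exact hL _ _ _ (by fun_prop) (by fun_prop) (by fun_prop)

lemma comp_measurableEquiv {X Y : Type*} [AddCommGroup X] [MeasurableSpace X]
    [AddCommGroup Y] [MeasurableSpace Y]
    {μ : Measure X} {ν : Measure Y} {K : Y → Y → ℝ≥0∞} {C : ℝ≥0∞}
    (hK : TrilinearBound ν K C) (e : X ≃ᵐ Y)
    (he : MeasurePreserving e μ ν) (hsub : ∀ x y, e (x - y) = e x - e y) :
    TrilinearBound μ (fun z x => K (e z) (e x)) C := by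
  intro F G H hF hG hH
  have h := hK (F ∘ e.symm) (G ∘ e.symm) (H ∘ e.symm) (by fun_prop) (by fun_prop) (by fun_prop)
  have hl : ∀ F : X → ℝ≥0∞, Measurable F → ltwo ν (F ∘ e.symm) = ltwo μ F := fun F hF =>
    (he.symm e).ltwo_comp hF
  rw [hl F hF, hl G hG, hl H hH, ← he.lintegral_comp_emb e.measurableEmbedding] at h
  refine le_of_eq_of_le (lintegral_congr fun z => ?_) h
  rw [← he.lintegral_comp_emb e.measurableEmbedding]
  simp [← hsub]

end TrilinearBound

section Bracket

variable {E : Type*} [NormedAddCommGroup E]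

/-- The weight `(1 + ‖x‖²) ^ p`, as an extended nonnegative real. -/
def bracket (p : ℝ) (x : E) : ℝ≥0∞ := ENNReal.ofReal ((1 + ‖x‖ ^ 2) ^ p)

lemma bracket_add (p q : ℝ) (x : E) : bracket (p + q) x = bracket p x * bracket q x := by
  rw [bracket, Real.rpow_add (by positivity), ENNReal.ofReal_mul (by positivity)]
  rfl

lemma bracket_sq (p : ℝ) (x : E) : bracket p x ^ 2 = bracket (2 * p) x := by
  rw [two_mul, bracket_add, sq]

lemma bracket_le_of_norm_le {x y : E} (p : ℝ) (h₁ : ‖x‖ ≤ 2 * ‖y‖) (h₂ : ‖y‖ ≤ 2 * ‖x‖) :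
    bracket p x ≤ ENNReal.ofReal (4 ^ |p|) * bracket p y := by
  rw [bracket, bracket, ← ENNReal.ofReal_mul (by positivity)]
  refine ENNReal.ofReal_le_ofReal ?_
  have hx := norm_nonneg x
  have hy := norm_nonneg y
  rcases le_total 0 p with hp | hp
  · rw [abs_of_nonneg hp, ← Real.mul_rpow (by positivity) (by positivity)]
    exact Real.rpow_le_rpow (by positivity) (by nlinarith) hp
  · rw [abs_of_nonpos hp, Real.rpow_neg (by positivity), ← Real.inv_rpow (by positivity),
      ← Real.mul_rpow (by positivity) (by positivity)]
    exact Real.rpow_le_rpow_of_nonpos (by positivity) (by nlinarith) hp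

/-- The part of the product kernel supported where `x` is the smallest frequency. -/
def lowKernel (δ p : ℝ) (z x : E) : ℝ≥0∞ :=
  {q : E × E | ‖q.2‖ ≤ ‖q.1‖}.indicator (fun q => bracket p q.2 * bracket (-(p + δ)) q.1) (z, x)

lemma lowKernel_of_le {δ p : ℝ} {z x : E} (h : ‖x‖ ≤ ‖z‖) :
    lowKernel δ p z x = bracket p x * bracket (-(p + δ)) z :=
  Set.indicator_of_mem (s := {q : E × E | ‖q.2‖ ≤ ‖q.1‖}) h _

/-- The multiplier comparing `H^{2a}`, `H^{2b}` and `H^{2(a + b - δ)}` weights in a product. -/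
def productKernel (δ a b : ℝ) (z x : E) : ℝ≥0∞ :=
  bracket (a + b - δ) z * bracket (-a) (z - x) * bracket (-b) x

lemma productKernel_le (δ a b : ℝ) (z x : E) :
    productKernel δ a b z x ≤ ENNReal.ofReal (4 ^ |a|) * lowKernel δ (-b) z x +
      (ENNReal.ofReal (4 ^ |b|) * lowKernel δ (-a) z (z - x) +
        ENNReal.ofReal (4 ^ |a|) * lowKernel δ (a + b - δ) x z) := by
  have h₁ : ‖z‖ ≤ ‖z - x‖ + ‖x‖ := by simpa using norm_add_le (z - x) x
  have h₂ : ‖z - x‖ ≤ ‖z‖ + ‖x‖ := norm_sub_le z x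
  have h₃ : ‖x‖ ≤ ‖z‖ + ‖z - x‖ := by simpa using norm_sub_le z (z - x)
  rw [productKernel]
  by_cases hx : ‖x‖ ≤ ‖z‖ ∧ ‖x‖ ≤ ‖z - x‖
  · refine le_add_of_le_of_nonneg ?_ zero_le
    rw [lowKernel_of_le hx.1, show -(-b + δ) = a + b - δ + -a by ring, bracket_add _ (-a)]
    have := bracket_le_of_norm_le (x := z - x) (y := z) (-a) (by linarith) (by linarith)
    rw [abs_neg] at this
    calc _ ≤ bracket (a + b - δ) z * (ENNReal.ofReal (4 ^ |a|) * bracket (-a) z) *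
          bracket (-b) x := by gcongr
      _ = _ := by ring
  refine le_add_of_nonneg_of_le zero_le ?_
  by_cases hzx : ‖z - x‖ ≤ ‖z‖ ∧ ‖z - x‖ ≤ ‖x‖
  · refine le_add_of_le_of_nonneg ?_ zero_le
    rw [lowKernel_of_le hzx.1, show -(-a + δ) = a + b - δ + -b by ring, bracket_add _ (-b)]
    have := bracket_le_of_norm_le (x := x) (y := z) (-b) (by linarith) (by linarith)
    rw [abs_neg] at this
    calc _ ≤ bracket (a + b - δ) z * bracket (-a) (z - x) *
          (ENNReal.ofReal (4 ^ |b|) * bracket (-b) z) := by gcongr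
      _ = _ := by ring
  · refine le_add_of_nonneg_of_le zero_le ?_
    have hz : ‖z‖ ≤ ‖x‖ ∧ ‖z‖ ≤ ‖z - x‖ := by grind
    rw [lowKernel_of_le hz.1, show -(a + b - δ + δ) = -a + -b by ring, bracket_add _ (-b)]
    have := bracket_le_of_norm_le (x := z - x) (y := x) (-a) (by linarith) (by linarith)
    rw [abs_neg] at this
    calc _ ≤ bracket (a + b - δ) z * (ENNReal.ofReal (4 ^ |a|) * bracket (-a) x) *
          bracket (-b) x := by gcongr
      _ = _ := by ring

variable [MeasurableSpace E] [BorelSpace E]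

@[fun_prop]
lemma measurable_bracket (p : ℝ) : Measurable (bracket p : E → ℝ≥0∞) := by
  unfold bracket
  fun_prop

lemma measurable_lowKernel (δ p : ℝ) :
    Measurable (Function.uncurry (lowKernel δ p : E → E → ℝ≥0∞)) :=
  Measurable.indicator (by fun_prop) (measurableSet_le (by fun_prop) (by fun_prop))

open Module Metric

variable [NormedSpace ℝ E] [FiniteDimensional ℝ E]

lemma measurable_productKernel (δ a b : ℝ) :
    Measurable (Function.uncurry (productKernel δ a b : E → E → ℝ≥0∞)) := by
  unfold productKernel Function.uncurry
  fun_prop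

variable (μ : Measure E) [μ.IsAddHaarMeasure]

lemma lintegral_comp_smul_addHaar {f : E → ℝ≥0∞} (hf : Measurable f) {r : ℝ} (hr : 0 < r) :
    ∫⁻ x, f x ∂μ = ENNReal.ofReal (r ^ finrank ℝ E) * ∫⁻ x, f (r • x) ∂μ := by
  rw [← lintegral_map hf (measurable_const_smul r), Measure.map_addHaar_smul μ hr.ne',
    lintegral_smul_measure, smul_eq_mul, ← mul_assoc, ← ENNReal.ofReal_mul (by positivity),
    abs_of_nonneg (by positivity), mul_inv_cancel₀ (by positivity)]
  simp

variable [Nontrivial E]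

lemma lintegral_ball_norm_rpow_lt_top {p c : ℝ} (hp : -(finrank ℝ E : ℝ) < p) :
    ∫⁻ x in ball (0 : E) 1, ENNReal.ofReal (‖x‖ ^ p + c) ∂μ < ∞ := by
  have h : IntegrableOn (fun x : E => ‖x‖ ^ p + c) (ball 0 1) μ := by
    refine Integrable.add ?_ (integrableOn_const measure_ball_lt_top.ne)
    rw [← IntegrableOn, integrableOn_fun_norm_addHaar μ (f := fun r => r ^ p)]
    have hd : 1 ≤ finrank ℝ E := finrank_pos
    have h1 : IntegrableOn (fun y : ℝ => y ^ ((finrank ℝ E : ℝ) - 1 + p)) (Set.Ioo 0 1) :=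
      (intervalIntegral.integrableOn_Ioo_rpow_iff zero_lt_one).2 (by linarith)
    refine h1.congr_fun (fun y hy => ?_) measurableSet_Ioo
    have : (finrank ℝ E : ℝ) - 1 = ((finrank ℝ E - 1 : ℕ) : ℝ) := by
      push_cast [hd]
      rfl
    simp only [smul_eq_mul]
    rw [Real.rpow_add hy.1, this, Real.rpow_natCast]
  exact h.lintegral_lt_top

lemma exists_lintegral_closedBall_bracket_le {p : ℝ} (hp : -(finrank ℝ E / 2 : ℝ) < p) :
    ∃ C ≠ ∞, ∀ R : ℝ, ∫⁻ x in closedBall (0 : E) R, bracket p x ∂μ ≤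
      C * ENNReal.ofReal ((1 + R ^ 2) ^ (p + finrank ℝ E / 2)) := by
  refine ⟨_, (lintegral_ball_norm_rpow_lt_top μ (p := 2 * p) (c := 2 ^ p) (by linarith)).ne,
    fun R => ?_⟩
  set w : ℝ := 1 + R ^ 2
  have hw : 1 ≤ w := by simp only [w]; nlinarith [sq_nonneg R]
  have hR : R < √w := Real.lt_sqrt_of_sq_lt (by simp [w])
  have hw0 : 0 < √w := by positivity
  have hsq : √w ^ 2 = w := Real.sq_sqrt (by positivity)
  rw [← lintegral_indicator measurableSet_closedBall, lintegral_comp_smul_addHaar μ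
    ((measurable_bracket p).indicator measurableSet_closedBall) hw0,
    Real.rpow_add (by positivity), ENNReal.ofReal_mul (by positivity),
    ← Real.rpow_natCast (√w), Real.sqrt_eq_rpow, ← Real.rpow_mul (by positivity),
    ← mul_assoc, mul_comm]
  rw [show 1 / 2 * (finrank ℝ E : ℝ) = finrank ℝ E / 2 by ring, ← Real.sqrt_eq_rpow]
  gcongr
  rw [← lintegral_indicator measurableSet_ball, mul_comm,
    ← lintegral_const_mul' _ _ ENNReal.ofReal_ne_top]
  refine lintegral_mono_ae ?_
  have hne : ∀ᵐ x : E ∂μ, x ≠ 0 := by simp [ae_iff]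
  filter_upwards [hne] with x hx
  by_cases hmem : √w • x ∈ closedBall (0 : E) R
  · have hx0 : 0 < ‖x‖ := norm_pos_iff.2 hx
    rw [mem_closedBall_zero_iff, norm_smul, Real.norm_of_nonneg hw0.le] at hmem
    have hx1 : ‖x‖ < 1 := by
      by_contra! h
      nlinarith
    rw [Set.indicator_of_mem (by simpa [norm_smul, abs_of_pos hw0] using hmem),
      Set.indicator_of_mem (by simpa using hx1), bracket, norm_smul, Real.norm_of_nonneg hw0.le,
      mul_pow, hsq, ← ENNReal.ofReal_mul (by positivity)]
    refine ENNReal.ofReal_le_ofReal ?_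
    have hx2 : ‖x‖ ^ 2 ≤ 1 := by nlinarith
    rcases le_total 0 p with hp0 | hp0
    · calc (1 + w * ‖x‖ ^ 2) ^ p ≤ (w * 2) ^ p :=
            Real.rpow_le_rpow (by positivity) (by nlinarith) hp0
        _ = w ^ p * 2 ^ p := Real.mul_rpow (by positivity) (by positivity)
        _ ≤ _ := by
          gcongr
          exact le_add_of_nonneg_left (by positivity)
    · calc (1 + w * ‖x‖ ^ 2) ^ p ≤ (w * ‖x‖ ^ 2) ^ p :=
            Real.rpow_le_rpow_of_nonpos (by positivity) (by linarith) hp0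
        _ = w ^ p * ‖x‖ ^ (2 * p) := by
          rw [Real.mul_rpow (by positivity) (by positivity), ← Real.rpow_natCast ‖x‖ 2,
            ← Real.rpow_mul (by positivity)]
          norm_num
        _ ≤ _ := by
          gcongr
          exact le_add_of_nonneg_right (by positivity)
  · rw [Set.indicator_of_notMem hmem]
    exact zero_le

lemma exists_trilinearBound_lowKernel {p : ℝ} (hp : -(finrank ℝ E / 4 : ℝ) < p) :
    ∃ C ≠ ∞, TrilinearBound μ (lowKernel (E := E) (finrank ℝ E / 4) p) C := by
  obtain ⟨C, hC, h⟩ := exists_lintegral_closedBall_bracket_le μ (p := 2 * p) (by linarith)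
  refine ⟨C ^ (1 / 2 : ℝ), ENNReal.rpow_ne_top_of_nonneg (by norm_num) hC,
    .of_lintegral_sq_le (measurable_lowKernel _ p) fun z => ?_⟩
  have hz : ∀ x, lowKernel (finrank ℝ E / 4) p z x ^ 2 = (closedBall (0 : E) ‖z‖).indicator
      (fun x => bracket (2 * p) x * bracket (-(2 * p + finrank ℝ E / 2)) z) x := fun x => by
    by_cases hx : ‖x‖ ≤ ‖z‖
    · rw [lowKernel_of_le hx, Set.indicator_of_mem (by simpa using hx), mul_pow, bracket_sq,
        bracket_sq]
      ring_nf
    · rw [lowKernel, Set.indicator_of_notMem (by simpa using hx),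
        Set.indicator_of_notMem (by simpa using hx), zero_pow two_ne_zero]
  simp_rw [hz]
  rw [lintegral_indicator measurableSet_closedBall, lintegral_mul_const _ (by fun_prop)]
  calc _ ≤ C * bracket (2 * p + finrank ℝ E / 2) z * bracket (-(2 * p + finrank ℝ E / 2)) z := by
        gcongr
        exact h ‖z‖
    _ = C := by
        rw [mul_assoc, ← bracket_add, add_neg_cancel, bracket]
        simp

lemma exists_trilinearBound_productKernel {a b : ℝ} (ha : a < finrank ℝ E / 4)
    (hb : b < finrank ℝ E / 4) (hab : 0 < a + b) :
    ∃ C ≠ ∞, TrilinearBound μ (productKernel (E := E) (finrank ℝ E / 4) a b) C := by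
  set δ : ℝ := finrank ℝ E / 4 with hδ
  obtain ⟨C₁, hC₁, h₁⟩ := exists_trilinearBound_lowKernel μ (p := -b) (by rw [← hδ]; linarith)
  obtain ⟨C₂, hC₂, h₂⟩ := exists_trilinearBound_lowKernel μ (p := -a) (by rw [← hδ]; linarith)
  obtain ⟨C₃, hC₃, h₃⟩ := exists_trilinearBound_lowKernel μ (p := a + b - δ)
    (by rw [← hδ]; linarith)
  have m₁ := (measurable_lowKernel (E := E) δ (-b)).const_mul (ENNReal.ofReal (4 ^ |a|))
  have m₂ : Measurable fun q : E × E =>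
      ENNReal.ofReal (4 ^ |b|) * lowKernel δ (-a) q.1 (q.1 - q.2) :=
    ((measurable_lowKernel (E := E) δ (-a)).comp
      (measurable_fst.prodMk (measurable_fst.sub measurable_snd))).const_mul _
  have h := (h₁.const_mul (ENNReal.ofReal_ne_top (r := 4 ^ |a|))).add
    ((h₂.reflect.const_mul (ENNReal.ofReal_ne_top (r := 4 ^ |b|))).add
      ((h₃.swap (measurable_lowKernel δ _)).const_mul (ENNReal.ofReal_ne_top (r := 4 ^ |a|))) m₂) m₁
  exact ⟨_, by finiteness, h.mono (productKernel_le δ a b)⟩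

end Bracket

section Anisotropic

/-- Splits a frequency in `ℝ³` into its vertical and horizontal parts. -/
def freqEquiv : E3 ≃ᵐ ℝ × ℂ :=
  (MeasurableEquiv.toLp 2 (Fin 3 → ℝ)).symm.trans <|
    (MeasurableEquiv.piFinSuccAbove (fun _ => ℝ) 2).trans <|
      (MeasurableEquiv.refl ℝ).prodCongr Complex.measurableEquivPi.symm

lemma freqEquiv_apply (ξ : E3) : freqEquiv ξ = (ξ 2, ⟨ξ 0, ξ 1⟩) := by
  refine Prod.ext rfl ?_
  change Complex.measurableEquivPi.symm ![ξ 0, ξ 1] = _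
  rw [Complex.measurableEquivPi_symm_apply]
  exact (Complex.mk_eq_add_mul_I _ _).symm

lemma measurePreserving_freqEquiv : MeasurePreserving freqEquiv :=
  ((MeasurePreserving.id volume).prod
    (Complex.volume_preserving_equiv_pi.symm Complex.measurableEquivPi)).comp <|
    (volume_preserving_piFinSuccAbove (fun _ => ℝ) 2).comp (PiLp.volume_preserving_ofLp (Fin 3))

/-- The square root of the weight in `anisoNorm`, as an extended nonnegative real. -/
def anisoWeight (σ₁ σ₂ : ℝ) (ξ : E3) : ℝ≥0∞ :=
  bracket (σ₂ / 2) (freqEquiv ξ).1 * bracket (σ₁ / 2) (freqEquiv ξ).2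

@[fun_prop]
lemma measurable_anisoWeight (σ₁ σ₂ : ℝ) : Measurable (anisoWeight σ₁ σ₂) := by
  unfold anisoWeight
  fun_prop

lemma anisoWeight_mul_neg (σ₁ σ₂ : ℝ) (ξ : E3) :
    anisoWeight σ₁ σ₂ ξ * anisoWeight (-σ₁) (-σ₂) ξ = 1 := by
  rw [anisoWeight, anisoWeight, mul_mul_mul_comm, ← bracket_add, ← bracket_add]
  simp [bracket, neg_div]

lemma anisoWeight_sq (σ₁ σ₂ : ℝ) (ξ : E3) : anisoWeight σ₁ σ₂ ξ ^ 2 =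
    ENNReal.ofReal ((1 + ((ξ 0) ^ 2 + (ξ 1) ^ 2)) ^ σ₁ * (1 + (ξ 2) ^ 2) ^ σ₂) := by
  rw [anisoWeight, mul_pow, bracket_sq, bracket_sq, bracket, bracket,
    ← ENNReal.ofReal_mul (by positivity), freqEquiv_apply, ← Complex.normSq_eq_norm_sq,
    Complex.normSq_mk, mul_comm, Real.norm_eq_abs, sq_abs]
  congr 3 <;> ring_nf

lemma anisoWeight_le_bracket (σ₁ σ₂ : ℝ) (ξ : E3) :
    anisoWeight σ₁ σ₂ ξ ≤ bracket ((|σ₁| + |σ₂|) / 2) ξ := by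
  have hb {E : Type} [NormedAddCommGroup E] (σ : ℝ) (x : E) (hx : ‖x‖ ^ 2 ≤ ‖ξ‖ ^ 2) :
      bracket (σ / 2) x ≤ bracket (|σ| / 2) ξ := by
    refine ENNReal.ofReal_le_ofReal ?_
    calc (1 + ‖x‖ ^ 2) ^ (σ / 2) ≤ (1 + ‖x‖ ^ 2) ^ (|σ| / 2) :=
          Real.rpow_le_rpow_of_exponent_le (by simp) (by gcongr; exact le_abs_self σ)
      _ ≤ _ := Real.rpow_le_rpow (by positivity) (by gcongr) (by positivity)
  have hξ : ‖ξ‖ ^ 2 = ξ 0 ^ 2 + ξ 1 ^ 2 + ξ 2 ^ 2 := by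
    rw [EuclideanSpace.real_norm_sq_eq, Fin.sum_univ_three]
  rw [anisoWeight, add_comm, add_div, bracket_add]
  gcongr
  · refine hb _ _ ?_
    rw [freqEquiv_apply, hξ, Real.norm_eq_abs, sq_abs]
    nlinarith [sq_nonneg (ξ 0), sq_nonneg (ξ 1)]
  · refine hb _ _ ?_
    rw [freqEquiv_apply, hξ, ← Complex.normSq_eq_norm_sq, Complex.normSq_mk]
    nlinarith [sq_nonneg (ξ 2)]

lemma anisoNorm_eq_toReal_ltwo (σ₁ σ₂ : ℝ) {f : E3 → ℂ} (hf : Measurable (𝓕 f)) :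
    anisoNorm σ₁ σ₂ f = (ltwo volume fun ξ => anisoWeight σ₁ σ₂ ξ * ‖𝓕 f ξ‖ₑ).toReal := by
  rw [anisoNorm, ltwo, ← ENNReal.toReal_rpow, integral_eq_lintegral_of_nonneg_ae]
  · congr 2
    refine lintegral_congr fun ξ => ?_
    rw [mul_pow, anisoWeight_sq, ENNReal.ofReal_mul (by positivity),
      ENNReal.ofReal_pow (norm_nonneg _), ofReal_norm]
  · exact Filter.Eventually.of_forall fun ξ => by positivity
  · fun_prop

lemma ltwo_anisoWeight_mul_ne_top (σ₁ σ₂ : ℝ) (f : SchwartzMap E3 ℂ) :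
    (ltwo volume fun ξ => anisoWeight σ₁ σ₂ ξ * ‖f ξ‖ₑ) ≠ ∞ := by
  set p := (|σ₁| + |σ₂|) / 2
  have h := (SchwartzMap.smulLeftCLM ℂ (fun x : E3 => (1 + ‖x‖ ^ 2) ^ p) f).eLpNorm_lt_top 2
  rw [eLpNorm_lt_top_iff_lintegral_rpow_enorm_lt_top two_ne_zero ENNReal.ofNat_ne_top] at h
  refine ENNReal.rpow_ne_top_of_nonneg (by norm_num) (ne_top_of_le_ne_top h.ne ?_)
  refine lintegral_mono fun ξ => ?_
  rw [SchwartzMap.smulLeftCLM_apply_apply (by fun_prop), enorm_smul, ENNReal.toReal_ofNat,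
    ENNReal.rpow_two]
  beta_reduce
  gcongr
  refine (anisoWeight_le_bracket σ₁ σ₂ ξ).trans_eq ?_
  rw [bracket, Real.enorm_of_nonneg (by positivity)]

lemma SchwartzMap.fourier_mul_eq_integral (u v : SchwartzMap E3 ℂ) (ξ : E3) :
    𝓕 (fun x => u x * v x) ξ = ∫ η, 𝓕 (v : E3 → ℂ) η * 𝓕 (u : E3 → ℂ) (ξ - η) := by
  have h := SchwartzMap.convolution_apply (ContinuousLinearMap.mul ℂ ℂ) (𝓕 v) (𝓕 u) ξ
  have hinv : ∀ (f : SchwartzMap E3 ℂ) (x : E3), 𝓕 (𝓕 f) x = f (-x) := fun f x => by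
    have h : 𝓕⁻ (𝓕 f) (-x) = f (-x) := by simp
    rw [← h, SchwartzMap.fourierInv_coe, Real.fourierInv_eq_fourier_neg, neg_neg,
      SchwartzMap.fourier_coe (𝓕 f)]
  have hconv : SchwartzMap.convolution (ContinuousLinearMap.mul ℂ ℂ) (𝓕 v) (𝓕 u) =
      𝓕⁻ (SchwartzMap.pairing (ContinuousLinearMap.mul ℂ ℂ) (𝓕 (𝓕 v)) (𝓕 (𝓕 u))) := rfl
  rw [hconv, SchwartzMap.fourierInv_coe, Real.fourierInv_eq_fourier_comp_neg] at h
  refine (congrArg (fun f : E3 → ℂ => 𝓕 f ξ) (funext fun x => ?_)).trans h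
  simp [SchwartzMap.pairing_apply_apply, hinv, mul_comm]

lemma enorm_fourier_mul_le (u v : SchwartzMap E3 ℂ) (ξ : E3) :
    ‖𝓕 (fun x => u x * v x) ξ‖ₑ ≤
      ∫⁻ η, ‖𝓕 (u : E3 → ℂ) (ξ - η)‖ₑ * ‖𝓕 (v : E3 → ℂ) η‖ₑ := by
  rw [SchwartzMap.fourier_mul_eq_integral]
  refine (enorm_integral_le_lintegral_enorm _).trans_eq (lintegral_congr fun η => ?_)
  rw [enorm_mul, mul_comm]

lemma exists_trilinearBound_anisoWeight {s t s' t' : ℝ} (hs : s < 1) (ht : t < 1)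
    (hst : 0 < s + t) (hs' : s' < 1 / 2) (ht' : t' < 1 / 2) (hst' : 0 < s' + t') :
    ∃ C ≠ ∞, TrilinearBound volume (fun ξ η : E3 => anisoWeight (s + t - 1) (s' + t' - 1 / 2) ξ *
      anisoWeight (-s) (-s') (ξ - η) * anisoWeight (-t) (-t') η) C := by
  have hsub : ∀ ξ η, freqEquiv (ξ - η) = freqEquiv ξ - freqEquiv η := fun ξ η => by
    simp only [freqEquiv_apply]
    exact Prod.ext rfl (Complex.ext rfl rfl)
  obtain ⟨C, hC, h⟩ := exists_trilinearBound_productKernel (volume : Measure ℝ)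
    (a := s' / 2) (b := t' / 2) (by norm_num; linarith) (by norm_num; linarith) (by linarith)
  obtain ⟨D, hD, h'⟩ := exists_trilinearBound_productKernel (volume : Measure ℂ)
    (a := s / 2) (b := t / 2) (by norm_num; linarith) (by norm_num; linarith) (by linarith)
  refine ⟨C * D, by finiteness, ((h.prod h' (measurable_productKernel _ _ _)
    (measurable_productKernel _ _ _)).comp_measurableEquiv freqEquiv
    measurePreserving_freqEquiv hsub).mono fun ξ η => le_of_eq ?_⟩
  rw [productKernel, productKernel, anisoWeight, anisoWeight, anisoWeight, hsub, Prod.fst_sub,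
    Prod.snd_sub, Module.finrank_self, Complex.finrank_real_complex]
  push_cast
  rw [show (s + t - 1) / 2 = s / 2 + t / 2 - 2 / 4 by ring,
    show (s' + t' - 1 / 2) / 2 = s' / 2 + t' / 2 - 1 / 4 by ring]
  simp only [neg_div]
  ring

end Anisotropic

theorem anisotropic_sobolev_product_law (s t s' t' : ℝ)
    (hs : s < 1) (ht : t < 1) (hst : 0 < s + t)
    (hs' : s' < 1/2) (ht' : t' < 1/2) (hst' : 0 < s' + t') :
    ∃ C > (0:ℝ), ∀ u v : SchwartzMap E3 ℂ,
      anisoNorm (s + t - 1) (s' + t' - 1/2) (fun x => u x * v x) ≤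
        C * anisoNorm s s' (u : E3 → ℂ) * anisoNorm t t' (v : E3 → ℂ) := by
  obtain ⟨C, hC, hbound⟩ := exists_trilinearBound_anisoWeight hs ht hst hs' ht' hst'
  refine ⟨C.toReal + 1, by positivity, fun u v => ?_⟩
  set w : SchwartzMap E3 ℂ := SchwartzMap.pairing (ContinuousLinearMap.mul ℂ ℂ) u v
  have hw : (fun x => u x * v x) = w := rfl
  have hmeas : ∀ f : SchwartzMap E3 ℂ, Measurable (𝓕 (f : E3 → ℂ)) := fun f =>
    (𝓕 f).continuous.measurable
  have hu := hmeas u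
  have hv := hmeas v
  have hwm := hmeas w
  set F : E3 → ℝ≥0∞ := fun ξ => anisoWeight s s' ξ * ‖𝓕 (u : E3 → ℂ) ξ‖ₑ
  set G : E3 → ℝ≥0∞ := fun ξ => anisoWeight t t' ξ * ‖𝓕 (v : E3 → ℂ) ξ‖ₑ
  set H : E3 → ℝ≥0∞ := fun ξ =>
    anisoWeight (s + t - 1) (s' + t' - 1 / 2) ξ * ‖𝓕 (w : E3 → ℂ) ξ‖ₑ
  have hF : ltwo volume F ≠ ∞ := ltwo_anisoWeight_mul_ne_top s s' (𝓕 u)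
  have hG : ltwo volume G ≠ ∞ := ltwo_anisoWeight_mul_ne_top t t' (𝓕 v)
  have hH : ltwo volume H ≠ ∞ := ltwo_anisoWeight_mul_ne_top _ _ (𝓕 w)
  have hle : ltwo volume H ^ 2 ≤ C * (ltwo volume F * ltwo volume G) * ltwo volume H := by
    rw [ltwo_sq, mul_assoc C]
    refine le_trans (lintegral_mono fun ξ => ?_)
      (hbound F G H (by fun_prop) (by fun_prop) (by fun_prop))
    have h1 : ∀ η, anisoWeight (s + t - 1) (s' + t' - 1 / 2) ξ * anisoWeight (-s) (-s') (ξ - η) *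
        anisoWeight (-t) (-t') η * (F (ξ - η) * G η * H ξ) =
        ‖𝓕 (u : E3 → ℂ) (ξ - η)‖ₑ * ‖𝓕 (v : E3 → ℂ) η‖ₑ *
          (anisoWeight (s + t - 1) (s' + t' - 1 / 2) ξ * H ξ) := fun η => by
      calc _ = (anisoWeight s s' (ξ - η) * anisoWeight (-s) (-s') (ξ - η)) *
            (anisoWeight t t' η * anisoWeight (-t) (-t') η) *
            (‖𝓕 (u : E3 → ℂ) (ξ - η)‖ₑ * ‖𝓕 (v : E3 → ℂ) η‖ₑ *
              (anisoWeight (s + t - 1) (s' + t' - 1 / 2) ξ * H ξ)) := by ring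
        _ = _ := by rw [anisoWeight_mul_neg, anisoWeight_mul_neg, one_mul, one_mul]
    simp_rw [h1]
    rw [lintegral_mul_const _ (by fun_prop), sq]
    calc H ξ * H ξ = ‖𝓕 (w : E3 → ℂ) ξ‖ₑ *
          (anisoWeight (s + t - 1) (s' + t' - 1 / 2) ξ * H ξ) := by ring
      _ ≤ _ := by
        gcongr
        exact enorm_fourier_mul_le u v ξ
  have hmain : ltwo volume H ≤ C * (ltwo volume F * ltwo volume G) := by
    rcases eq_or_ne (ltwo volume H) 0 with h0 | h0
    · rw [h0]
      exact zero_le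
    · rwa [sq, ENNReal.mul_le_mul_iff_left h0 hH] at hle
  rw [hw, anisoNorm_eq_toReal_ltwo _ _ hwm, anisoNorm_eq_toReal_ltwo _ _ hu,
    anisoNorm_eq_toReal_ltwo _ _ hv, mul_assoc]
  calc (ltwo volume H).toReal ≤ (C * (ltwo volume F * ltwo volume G)).toReal :=
        ENNReal.toReal_mono (by finiteness) hmain
    _ = C.toReal * ((ltwo volume F).toReal * (ltwo volume G).toReal) := by
        rw [ENNReal.toReal_mul, ENNReal.toReal_mul]
    _ ≤ _ := by
        gcongr
        linarith
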